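/- Let A₁ and A₂ be complex Banach algebras and let A₁ ⊕ A₂ denote their direct sum, the Banach algebra on the Cartesian product with coordinatewise operations and norm ‖(a₁,a₂)‖ = ‖a₁‖ + ‖a₂‖. If A₁ ⊕ A₂ is point amenable, then A₁ and A₂ are point amenable; conversely, if A₁ and A₂ are essential (the linear span of products is dense) and point amenable, then A₁ ⊕ A₂ is point amenable. -/

import Mathlib

/-- A continuous linear functional `φ` on `A` is *multiplicative* when `φ(ab) = φ(a)φ(b)`.
The nonzero such functionals are the characters of `A` (the set `Δ(A)`); together with `0`
they form `Δ₀(A)`. -/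
def IsMulFunctional {A : Type*} [NonUnitalNormedRing A] [NormedSpace ℂ A]
    (φ : A →L[ℂ] ℂ) : Prop :=
  ∀ a b : A, φ (a * b) = φ a * φ b

/-- `d ∈ A*` is a *continuous point derivation* of `A` at `φ` when
`d(ab) = d(a)φ(b) + φ(a)d(b)` for all `a, b ∈ A`. -/
def IsPointDerivationAt {A : Type*} [NonUnitalNormedRing A] [NormedSpace ℂ A]
    (φ d : A →L[ℂ] ℂ) : Prop :=
  ∀ a b : A, d (a * b) = d a * φ b + φ a * d b

/-- `A` is *0-point amenable* if the only continuous point derivation of `A` at any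
`φ ∈ Δ₀(A)` (i.e. any multiplicative functional, zero allowed) is zero. -/
def ZeroPointAmenable (A : Type*) [NonUnitalNormedRing A] [NormedSpace ℂ A] : Prop :=
  ∀ φ d : A →L[ℂ] ℂ, IsMulFunctional φ → IsPointDerivationAt φ d → d = 0

/-- `A` is *point amenable* if the only continuous point derivation of `A` at any character
`φ ∈ Δ(A)` (i.e. any nonzero multiplicative functional) is zero. -/
def PointAmenable (A : Type*) [NonUnitalNormedRing A] [NormedSpace ℂ A] : Prop :=
  ∀ φ d : A →L[ℂ] ℂ, IsMulFunctional φ → φ ≠ 0 → IsPointDerivationAt φ d → d = 0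

/-- A Banach algebra `A` is *essential* if the linear span of products `{ab : a, b ∈ A}`
is dense in `A`. -/
def IsEssential (A : Type*) [NonUnitalNormedRing A] [NormedSpace ℂ A] : Prop :=
  Dense ((Submodule.span ℂ {x : A | ∃ a b : A, x = a * b} : Submodule ℂ A) : Set A)

namespace L1Prod

variable {α β : Type*} [NonUnitalNormedRing α] [NonUnitalNormedRing β]

noncomputable instance : NonUnitalRing (WithLp 1 (α × β)) :=
  { (inferInstance : AddCommGroup (WithLp 1 (α × β))) with
    mul := fun x y => WithLp.toLp 1 (x.ofLp * y.ofLp)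
    left_distrib := fun x y z => congrArg (WithLp.toLp 1) (mul_add x.ofLp y.ofLp z.ofLp)
    right_distrib := fun x y z => congrArg (WithLp.toLp 1) (add_mul x.ofLp y.ofLp z.ofLp)
    zero_mul := fun x => congrArg (WithLp.toLp 1) (zero_mul x.ofLp)
    mul_zero := fun x => congrArg (WithLp.toLp 1) (mul_zero x.ofLp)
    mul_assoc := fun x y z => congrArg (WithLp.toLp 1) (mul_assoc x.ofLp y.ofLp z.ofLp) }

lemma norm_def (x : WithLp 1 (α × β)) : ‖x‖ = ‖x.fst‖ + ‖x.snd‖ := by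
  rw [WithLp.prod_norm_eq_add (by norm_num)]
  norm_num

lemma mul_fst (x y : WithLp 1 (α × β)) : (x * y).fst = x.fst * y.fst := rfl
lemma mul_snd (x y : WithLp 1 (α × β)) : (x * y).snd = x.snd * y.snd := rfl

/-- The direct sum `A₁ ⊕ A₂` of two (non-unital) normed rings, i.e. the Cartesian product
with coordinatewise operations and the norm `‖(a₁, a₂)‖ = ‖a₁‖ + ‖a₂‖`, as a normed ring. -/
noncomputable instance : NonUnitalNormedRing (WithLp 1 (α × β)) :=
  { (inferInstance : NormedAddCommGroup (WithLp 1 (α × β))),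
    (inferInstance : NonUnitalRing (WithLp 1 (α × β))) with
    dist_eq := dist_eq_norm_neg_add
    norm_mul_le := fun x y => by
      simp only [norm_def, mul_fst, mul_snd]
      have h1 : ‖x.fst * y.fst‖ + ‖x.snd * y.snd‖ ≤ ‖x.fst‖ * ‖y.fst‖ + ‖x.snd‖ * ‖y.snd‖ :=
        add_le_add (norm_mul_le _ _) (norm_mul_le _ _)
      refine h1.trans ?_
      nlinarith [norm_nonneg x.fst, norm_nonneg x.snd, norm_nonneg y.fst, norm_nonneg y.snd] }

variable [NormedSpace ℂ α] [NormedSpace ℂ β]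
  [IsScalarTower ℂ α α] [SMulCommClass ℂ α α] [IsScalarTower ℂ β β] [SMulCommClass ℂ β β]

noncomputable instance : IsScalarTower ℂ (WithLp 1 (α × β)) (WithLp 1 (α × β)) :=
  ⟨fun c x y => congrArg (WithLp.toLp 1) (smul_assoc c x.ofLp y.ofLp)⟩

noncomputable instance : SMulCommClass ℂ (WithLp 1 (α × β)) (WithLp 1 (α × β)) :=
  ⟨fun c x y => congrArg (WithLp.toLp 1) (smul_comm c x.ofLp y.ofLp)⟩

end L1Prod

theorem IsMulFunctional.comp {A B : Type*}
    [NonUnitalNormedRing A] [NormedSpace ℂ A] [NonUnitalNormedRing B] [NormedSpace ℂ B]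
    {φ : B →L[ℂ] ℂ} (hφ : IsMulFunctional φ) {f : A →L[ℂ] B}
    (hf : ∀ a b : A, f (a * b) = f a * f b) : IsMulFunctional (φ.comp f) := fun a b => by
  simp [hf, hφ (f a) (f b)]

theorem IsPointDerivationAt.comp {A B : Type*}
    [NonUnitalNormedRing A] [NormedSpace ℂ A] [NonUnitalNormedRing B] [NormedSpace ℂ B]
    {φ d : B →L[ℂ] ℂ} (hd : IsPointDerivationAt φ d) {f : A →L[ℂ] B}
    (hf : ∀ a b : A, f (a * b) = f a * f b) :
    IsPointDerivationAt (φ.comp f) (d.comp f) := fun a b => by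
  simp [hf, hd (f a) (f b)]

/-- Point amenability passes to the image of a continuous multiplicative surjection. -/
theorem PointAmenable.of_surjective {A B : Type*}
    [NonUnitalNormedRing A] [NormedSpace ℂ A] [NonUnitalNormedRing B] [NormedSpace ℂ B]
    (hA : PointAmenable A) (π : A →L[ℂ] B) (hπ : Function.Surjective π)
    (hmul : ∀ a b : A, π (a * b) = π a * π b) : PointAmenable B := by
  have comp_eq_zero {f : B →L[ℂ] ℂ} (hf : f.comp π = 0) : f = 0 := by
    ext b
    obtain ⟨a, rfl⟩ := hπ b
    exact DFunLike.congr_fun hf a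
  intro φ d hφ hφ0 hd
  exact comp_eq_zero (hA (φ.comp π) (d.comp π) (hφ.comp hmul)
    (fun h => hφ0 (comp_eq_zero h)) (hd.comp hmul))

/-- An essential point amenable algebra is `0`-point amenable. -/
theorem PointAmenable.zeroPointAmenable {A : Type*} [NonUnitalNormedRing A] [NormedSpace ℂ A]
    (hA : PointAmenable A) (hess : IsEssential A) : ZeroPointAmenable A := by
  intro φ d hφ hd
  by_cases hφ0 : φ = 0
  · refine ContinuousLinearMap.ext_on hess ?_
    rintro _ ⟨a, b, rfl⟩
    simp [hd a b, hφ0]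
  · exact hA φ d hφ hφ0 hd

/-- The direct sum of two `0`-point amenable algebras is `0`-point amenable. -/
theorem ZeroPointAmenable.directSum {A₁ A₂ : Type*}
    [NonUnitalNormedRing A₁] [NormedSpace ℂ A₁] [NonUnitalNormedRing A₂] [NormedSpace ℂ A₂]
    (h₁ : ZeroPointAmenable A₁) (h₂ : ZeroPointAmenable A₂) :
    ZeroPointAmenable (WithLp 1 (A₁ × A₂)) := by
  intro φ d hφ hd
  let e := (WithLp.prodContinuousLinearEquiv 1 ℂ A₁ A₂).symm
  let i₁ : A₁ →L[ℂ] WithLp 1 (A₁ × A₂) := e.toContinuousLinearMap.comp (.inl ℂ A₁ A₂)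
  let i₂ : A₂ →L[ℂ] WithLp 1 (A₁ × A₂) := e.toContinuousLinearMap.comp (.inr ℂ A₁ A₂)
  have hi₁ (a b : A₁) : i₁ (a * b) = i₁ a * i₁ b :=
    congrArg (WithLp.toLp 1) (Prod.ext rfl (mul_zero (0 : A₂)).symm)
  have hi₂ (a b : A₂) : i₂ (a * b) = i₂ a * i₂ b :=
    congrArg (WithLp.toLp 1) (Prod.ext (mul_zero (0 : A₁)).symm rfl)
  have hd₁ := h₁ _ _ (hφ.comp hi₁) (hd.comp hi₁)
  have hd₂ := h₂ _ _ (hφ.comp hi₂) (hd.comp hi₂)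
  ext x
  have hx : x = i₁ x.fst + i₂ x.snd :=
    congrArg (WithLp.toLp 1) (Prod.ext (add_zero x.fst).symm (zero_add x.snd).symm)
  have hx₁ : d (i₁ x.fst) = 0 := DFunLike.congr_fun hd₁ x.fst
  have hx₂ : d (i₂ x.snd) = 0 := DFunLike.congr_fun hd₂ x.snd
  rw [hx, map_add, hx₁, hx₂, add_zero, zero_apply]

/-- For complex Banach algebras `A₁`, `A₂` and their direct sum `A₁ ⊕ A₂`
(norm `‖(a₁,a₂)‖ = ‖a₁‖ + ‖a₂‖`): if `A₁ ⊕ A₂` is point amenable then so are `A₁` and `A₂`;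
conversely, if `A₁` and `A₂` are essential and point amenable then `A₁ ⊕ A₂` is point
amenable. -/
theorem pointAmenable_directSum {A₁ A₂ : Type*}
    [NonUnitalNormedRing A₁] [NormedSpace ℂ A₁] [IsScalarTower ℂ A₁ A₁]
    [SMulCommClass ℂ A₁ A₁] [CompleteSpace A₁]
    [NonUnitalNormedRing A₂] [NormedSpace ℂ A₂] [IsScalarTower ℂ A₂ A₂]
    [SMulCommClass ℂ A₂ A₂] [CompleteSpace A₂] :
    (PointAmenable (WithLp 1 (A₁ × A₂)) → PointAmenable A₁ ∧ PointAmenable A₂) ∧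
      (IsEssential A₁ → IsEssential A₂ → PointAmenable A₁ → PointAmenable A₂ →
        PointAmenable (WithLp 1 (A₁ × A₂))) := by
  refine ⟨fun h => ⟨?_, ?_⟩, fun e₁ e₂ h₁ h₂ φ d hφ _ hd =>
    (h₁.zeroPointAmenable e₁).directSum (h₂.zeroPointAmenable e₂) φ d hφ hd⟩
  · exact h.of_surjective (WithLp.fstL 1 ℂ A₁ A₂)
      (fun a => ⟨WithLp.toLp 1 (a, 0), rfl⟩) fun _ _ => rfl
  · exact h.of_surjective (WithLp.sndL 1 ℂ A₁ A₂)
      (fun a => ⟨WithLp.toLp 1 (0, a), rfl⟩) fun _ _ => rfl
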